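/- arXiv:math/0201265 — 2 statements merged into one kernel-verified Lean document; each statement's English description precedes it below -/
import Mathlib

section
/- Define t_n = 1 if 7 ∤ τ(n) and t_n = 0 otherwise, and let T(s) = ∑_{n=1}^∞ t_n·n^{-s}. Let χ₋₇ be the quadratic Dirichlet character modulo 7 (the Kronecker character of ℚ(√−7)). Then for real s > 1, T(s) = ∏_{p ≡ 3,5,6 (mod 7)} (1 − p^{-2s})^{-1} · ∏_{p ≡ 1,2,4 (mod 7)} (1 − p^{-6s})/((1 − p^{-s})(1 − p^{-7s})), and moreover T(s)² = ζ(s)·L(s,χ₋₇)·(1 − 7^{-s}) · ∏_{p ≡ 3,5,6 (mod 7)} (1 − p^{-2s})^{-1} · ∏_{p ≡ 1,2,4 (mod 7)} ((1 − p^{-6s})/(1 − p^{-7s}))², all products over primes in the indicated residue classes. -/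
open Finset

/-- Ramanujan's tau function, defined by
`q ∏_{n≥1} (1 - q^n)^24 = ∑_{n≥1} τ(n) q^n`; the coefficient of `q^n` only
involves the factors with index at most `n`. -/
noncomputable def ramanujanTau (n : ℕ) : ℤ :=
  (Polynomial.X * ∏ k ∈ Finset.Icc 1 n, ((1 : Polynomial ℤ) - Polynomial.X ^ k) ^ 24).coeff n

/-- `t n = 1` if `7 ∤ τ(n)`, and `t n = 0` otherwise. -/
noncomputable def t7 (n : ℕ) : ℝ := if (7 : ℤ) ∣ ramanujanTau n then 0 else 1

instance : Fact (Nat.Prime 7) := ⟨by norm_num⟩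

open UpperHalfPlane in
lemma tau_coeff_stable (n N : ℕ) (h : n ≤ N) :
    (Polynomial.X * ∏ k ∈ Finset.Icc 1 N, ((1 : Polynomial ℤ) - Polynomial.X ^ k) ^ 24).coeff n
      = ramanujanTau n := by
  induction N, h using Nat.le_induction with
  | base => rfl
  | succ N hN ih =>
    rw [← ih, Finset.prod_Icc_succ_top (by omega)]
    obtain ⟨r, hr⟩ : ∃ r : Polynomial ℤ, (1 - Polynomial.X ^ (N+1)) ^ 24
        = 1 + Polynomial.X ^ (N+1) * r := by
      have := sub_dvd_pow_sub_pow ((1 : Polynomial ℤ) - Polynomial.X ^ (N+1)) 1 24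
      obtain ⟨c, hc⟩ := this
      exact ⟨-c, by linear_combination hc⟩
    rw [hr, mul_add, mul_one, mul_add, Polynomial.coeff_add, add_eq_left]
    rw [show ∀ P : Polynomial ℤ, Polynomial.X * (P * (Polynomial.X ^ (N+1) * r)) =
      Polynomial.X * P * r * Polynomial.X ^ (N+1) by intro P; ring,
      Polynomial.coeff_mul_X_pow', if_neg (by omega)]

lemma tlu_iterDeriv {F : ℕ → ℂ → ℂ} {f : ℂ → ℂ} {U : Set ℂ} (hU : IsOpen U)
    (hF : ∀ n, Differentiable ℂ (F n))
    (h : TendstoLocallyUniformlyOn F f Filter.atTop U) (m : ℕ) :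
    TendstoLocallyUniformlyOn (fun n => iteratedDeriv m (F n)) (iteratedDeriv m f)
      Filter.atTop U := by
  induction m with
  | zero => simpa using h
  | succ m ih =>
    simp only [iteratedDeriv_succ]
    refine ih.deriv (.of_forall fun n => ?_) hU
    exact (((hF n).contDiff (n := (⊤ : ℕ∞))).differentiable_iteratedDeriv m (by
      exact_mod_cast WithTop.coe_lt_top _)).differentiableOn

lemma iterDeriv_poly (p : Polynomial ℂ) (m : ℕ) :
    iteratedDeriv m (fun x => p.eval x) = fun x => (Polynomial.derivative^[m] p).eval x := by
  induction m with
  | zero => simp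
  | succ m ih =>
    rw [iteratedDeriv_succ, ih, Function.iterate_succ_apply']
    ext x; simp

lemma disc_coeff (n : ℕ) :
    (UpperHalfPlane.qExpansion 1 ModularForm.discriminant).coeff n = (ramanujanTau n : ℂ) := by
  rw [UpperHalfPlane.qExpansion_coeff]
  have hmem : (0 : ℂ) ∈ Metric.ball (0 : ℂ) 1 := Metric.mem_ball_self one_pos
  let P : ℕ → Polynomial ℤ := fun N =>
    Polynomial.X * ∏ k ∈ Finset.Icc 1 N, ((1 : Polynomial ℤ) - Polynomial.X ^ k) ^ 24
  let Q : ℕ → Polynomial ℂ := fun N => (P N).map (Int.castRingHom ℂ)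
  have hev : ∀ N q, (Q N).eval q = q * (∏ i ∈ Finset.range N, (1 - q ^ (i+1))) ^ 24 := by
    intro N q
    simp only [Q, P, Polynomial.map_mul, Polynomial.map_X, Polynomial.map_prod, Polynomial.map_pow,
      Polynomial.map_sub, Polynomial.map_one, Polynomial.eval_mul, Polynomial.eval_X,
      Polynomial.eval_prod, Polynomial.eval_pow, Polynomial.eval_sub, Polynomial.eval_one]
    rw [Finset.prod_pow, Finset.range_eq_Ico, Finset.prod_Ico_add' (fun k => 1 - q ^ k) 0 N 1]
    rfl
  have hT0 : TendstoLocallyUniformlyOn (fun N q => ∏ i ∈ Finset.range N, (1 - q ^ (i+1)))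
      (fun q : ℂ => ∏' i, (1 - q ^ (i+1))) Filter.atTop (Metric.ball 0 1) := by
    have := ModularForm.multipliableLocallyUniformlyOn_one_sub_pow.hasProdLocallyUniformlyOn
    exact this.tendstoLocallyUniformlyOn_finsetRange
  have hT : TendstoLocallyUniformlyOn (fun N q => (Q N).eval q)
      (UpperHalfPlane.cuspFunction 1 ModularForm.discriminant) Filter.atTop (Metric.ball 0 1) := by
    have hc : ContinuousOn (fun q : ℂ => ∏' i, (1 - q ^ (i+1))) (Metric.ball 0 1) :=
      ModularForm.differentiableOn_tprod_one_sub_pow.continuousOn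
    have hp : ∀ k : ℕ, TendstoLocallyUniformlyOn
        (fun N q => q * (∏ i ∈ Finset.range N, (1 - q ^ (i+1))) ^ k)
        (fun q : ℂ => q * (∏' i, (1 - q ^ (i+1))) ^ k) Filter.atTop (Metric.ball 0 1) := by
      intro k
      induction k with
      | zero =>
        simp only [pow_zero, mul_one]
        intro u hu x hx
        exact ⟨Set.univ, Filter.univ_mem, .of_forall fun n y _ => refl_mem_uniformity hu⟩
      | succ k ih =>
        have := ih.mul₀ hT0 (continuousOn_id.mul (hc.pow k)) hc
        refine (this.congr (fun N q _ => ?_)).congr_right (fun q _ => ?_) <;>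
        simp [pow_succ, mul_assoc]
    refine ((hp 24).congr (fun N q _ => (hev N q).symm)).congr_right (fun q hq => ?_)
    rw [ModularForm.discriminant_cuspFunction_eqOn hq]
    simp only
    rw [(ModularForm.multipliable_one_sub_pow (by simpa using hq)).tprod_pow]
  have h1 := (tlu_iterDeriv Metric.isOpen_ball (fun N => (Q N).differentiable) hT n).tendsto_at hmem
  have h2 : ∀ᶠ N in Filter.atTop, (n.factorial : ℂ) * (ramanujanTau n : ℂ)
      = iteratedDeriv n (fun q => (Q N).eval q) 0 := by
    filter_upwards [Filter.eventually_ge_atTop n] with N hN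
    rw [iterDeriv_poly]
    simp only [← Polynomial.coeff_zero_eq_eval_zero]
    rw [Polynomial.coeff_iterate_derivative]
    have : (Q N).coeff n = (ramanujanTau n : ℂ) := by
      rw [← tau_coeff_stable n N hN]
      simp only [Q, P, Polynomial.coeff_map, eq_intCast]
    simp [this, Nat.descFactorial_self]
  have h3 := tendsto_nhds_unique (tendsto_const_nhds.congr' h2) h1
  rw [← h3, inv_mul_cancel_left₀ (by exact_mod_cast n.factorial_ne_zero)]

open UpperHalfPlane ModularForm EisensteinSeries Derivative Manifold MatrixGroups in
lemma analytic_of_hasSum {f : ℍ → ℂ} {c : ℕ → ℂ} (hd : MDiff f)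
    (hf : ∀ τ : ℍ, HasSum (fun m ↦ c m • Function.Periodic.qParam 1 τ ^ m) (f τ)) :
    AnalyticAt ℂ (cuspFunction 1 f) 0 ∧ ∀ m, (qExpansion 1 f).coeff m = c m := by
  have hper : Function.Periodic (f ∘ ofComplex) (1 : ℝ) := by
    intro z
    by_cases hz : 0 < z.im
    · have hz' : 0 < (z + (1 : ℝ)).im := by simpa using hz
      simp only [Function.comp, ofComplex_apply_of_im_pos hz, ofComplex_apply_of_im_pos hz']
      have h1 := hf ⟨z + (1 : ℝ), hz'⟩
      have h2 := hf ⟨z, hz⟩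
      simp only at h1 h2
      have hp : Function.Periodic.qParam 1 (z + (1 : ℝ)) = Function.Periodic.qParam 1 z := by
        simp only [Function.Periodic.qParam]
        rw [← Complex.exp_periodic (2 * Real.pi * Complex.I * z / (1 : ℝ))]
        congr 1
        push_cast
        ring
      rw [hp] at h1
      exact h1.unique h2
    · have hz' : ¬ 0 < (z + (1 : ℝ)).im := by simpa using hz
      simp only [Function.comp, ofComplex_apply_of_im_nonpos (not_lt.mp hz),
        ofComplex_apply_of_im_nonpos (not_lt.mp hz')]
  have hB : IsBoundedAtImInfty f := isBoundedAtImInfty_of_hasSum_qExpansion (h := 1) one_pos hf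
  have hA : AnalyticAt ℂ (cuspFunction 1 f) 0 :=
    UpperHalfPlane.analyticAt_cuspFunction_zero (h := 1) one_pos hper hd hB
  refine ⟨hA, fun m => ?_⟩
  have h1 := (hasFPowerSeriesOnBall_cuspFunction (h := 1) one_pos hA hf).hasFPowerSeriesAt
  have h2 := congr_arg (FormalMultilinearSeries.coeff · m)
    (h1.eq_formalMultilinearSeries hA.hasFPowerSeriesAt)
  simp only [FormalMultilinearSeries.coeff_ofScalars] at h2
  rw [qExpansion_coeff, h2, div_eq_inv_mul]

open UpperHalfPlane ModularForm EisensteinSeries Derivative Manifold MatrixGroups in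
lemma hasSum_D_E4 (τ : ℍ) : HasSum (fun m : ℕ ↦ ((m : ℂ) * (qExpansion 1 E₄).coeff m) •
    Function.Periodic.qParam 1 τ ^ m) (normalizedDerivOfComplex E₄ τ) := by
  set f := cuspFunction 1 E₄ with hfdef
  have hdiff : DifferentiableOn ℂ f (Metric.ball 0 1) :=
    fun z hz => (ModularFormClass.differentiableAt_cuspFunction E₄ one_pos
      one_mem_strictPeriods_SL (by simpa using hz)).differentiableWithinAt
  set q := Function.Periodic.qParam 1 τ with hq
  have hqn : ‖q‖ < 1 := Function.Periodic.norm_qParam_lt_one one_pos τ.im_pos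
  have hqm : q ∈ Metric.ball (0 : ℂ) 1 := by simpa using hqn
  have hD : normalizedDerivOfComplex E₄ τ = q * deriv f q := by
    have h1 : (E₄ ∘ ofComplex) =ᶠ[nhds (τ : ℂ)] (f ∘ Function.Periodic.qParam 1) := by
      filter_upwards [isOpen_upperHalfPlaneSet.mem_nhds τ.2] with z hz
      have := SlashInvariantFormClass.eq_cuspFunction (h := 1) E₄ ⟨z, hz⟩ one_mem_strictPeriods_SL one_ne_zero
      simp only [Function.comp, ofComplex_apply_of_im_pos hz]
      exact this.symm
    have h2 : HasDerivAt (Function.Periodic.qParam 1) (2 * Real.pi * Complex.I * q) (τ : ℂ) := by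
      have h3 : HasDerivAt (fun z : ℂ => 2 * Real.pi * Complex.I * z / (1 : ℝ)) (2 * Real.pi * Complex.I) (τ : ℂ) := by
        simpa using (hasDerivAt_id (τ : ℂ)).const_mul (2 * Real.pi * Complex.I)
      have := h3.cexp
      simp only [hq, Function.Periodic.qParam]
      rw [mul_comm]
      exact this
    have h4 : HasDerivAt f (deriv f q) q :=
      (hdiff.differentiableAt (Metric.isOpen_ball.mem_nhds hqm)).hasDerivAt
    rw [normalizedDerivOfComplex, h1.deriv_eq, (h4.comp (τ : ℂ) h2).deriv]
    have : (2 * Real.pi * Complex.I : ℂ) ≠ 0 := Complex.two_pi_I_ne_zero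
    field_simp
  have hT := Complex.hasSum_taylorSeries_on_ball (hdiff.deriv Metric.isOpen_ball) hqm
  rw [hD, ← hasSum_nat_add_iff' 1]
  simp only [Finset.range_one, Finset.sum_singleton, Nat.cast_zero, zero_mul, zero_smul, sub_zero]
  rw [show (fun m : ℕ => (((m + 1 : ℕ) : ℂ) * (qExpansion 1 E₄).coeff (m + 1)) • q ^ (m + 1)) =
    fun m => q * ((m.factorial : ℂ)⁻¹ • (q - 0) ^ m • iteratedDeriv m (deriv f) 0) from ?_]
  · exact hT.mul_left q
  ext m
  rw [qExpansion_coeff, ← iteratedDeriv_succ', Nat.factorial_succ]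
  have h1 : ((m : ℂ) + 1) ≠ 0 := by exact_mod_cast m.succ_ne_zero
  have h2 : (m.factorial : ℂ) ≠ 0 := by exact_mod_cast m.factorial_ne_zero
  simp only [smul_eq_mul, sub_zero]
  push_cast
  field_simp
  ring

open UpperHalfPlane ModularForm EisensteinSeries Derivative Manifold MatrixGroups in
noncomputable def serreForm : ModularForm 𝒮ℒ 6 where
  toFun := serreDerivative (4 : ℤ) E₄
  slash_action_eq' A hA := by
    obtain ⟨A, rfl⟩ := hA
    have := serreDerivative_slash_invariant (k := 4) (F := E₄) E₄.holo' (γ := A)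
      (E₄.slash_action_eq' _ ⟨A, rfl⟩)
    exact this
  holo' := serreDerivative_mdifferentiable _ E₄.holo'
  bdd_at_cusps' hc := by
    rw [Subgroup.IsArithmetic.isCusp_iff_isCusp_SL2Z] at hc
    rw [OnePoint.isBoundedAt_iff_forall_SL2Z hc]
    intro γ _
    rw [show serreDerivative (4 : ℤ) E₄ ∣[(6 : ℤ)] γ = serreDerivative (4 : ℤ) E₄ from
      serreDerivative_slash_invariant (k := 4) (F := E₄) E₄.holo' (γ := γ)
      (E₄.slash_action_eq' _ ⟨γ, rfl⟩)]
    have h1 : IsBoundedAtImInfty (normalizedDerivOfComplex E₄) :=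
      isBoundedAtImInfty_of_hasSum_qExpansion one_pos hasSum_D_E4
    have h2 : IsBoundedAtImInfty E₄ := ModularFormClass.bdd_at_infty E₄
    have h3 := isBoundedAtImInfty_E2
    have he : serreDerivative (4 : ℤ) E₄ = normalizedDerivOfComplex E₄ +
        -((4 * 12⁻¹ : ℂ) • (E2 * ⇑E₄)) := by
      ext z; simp [mul_assoc, sub_eq_add_neg]
    rw [he]
    refine Filter.BoundedAtFilter.add h1 (Filter.BoundedAtFilter.neg ?_)
    exact Filter.BoundedAtFilter.smul (4 * 12⁻¹ : ℂ) (Filter.BoundedAtFilter.mul h3 h2)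

open UpperHalfPlane ModularForm EisensteinSeries in
lemma E4_sq : (qExpansion 1 E₄) ^ 2 = qExpansion 1 (E (by norm_num : 3 ≤ 8)) := by
  let f : ModularForm (Matrix.SpecialLinearGroup.mapGL ℝ : Matrix.SpecialLinearGroup (Fin 2) ℤ →* _).range 8 := ModularForm.mcast (by decide) (E₄.pow 2) - E (by norm_num : 3 ≤ 8)
  have hf : qExpansion 1 f = (qExpansion 1 E₄) ^ 2 - qExpansion 1 (E (by norm_num : 3 ≤ 8)) := by
    simp only [f, FunLike.coe_sub, coe_mcast,
    ModularForm.qExpansion_sub one_pos one_mem_strictPeriods_SL,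
    ModularForm.qExpansion_pow one_pos one_mem_strictPeriods_SL]
  have h0 : f = 0 := by
    apply sturm_bound_levelOne
    rw [hf]
    change ((0 : ℕ) : ℕ∞) < _
    rw [Nat.cast_zero, pos_iff_ne_zero, PowerSeries.order_ne_zero_iff_constCoeff_eq_zero, map_sub,
      map_pow, ← PowerSeries.coeff_zero_eq_constantCoeff_apply,
      ← PowerSeries.coeff_zero_eq_constantCoeff_apply, E_qExpansion_coeff_zero _ ⟨2, rfl⟩,
      E_qExpansion_coeff_zero _ ⟨4, rfl⟩]
    simp
  rw [← sub_eq_zero, ← hf, h0]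
  exact qExpansion_zero 1

open UpperHalfPlane ModularForm EisensteinSeries Derivative Manifold MatrixGroups in
lemma serre_identity : 3 • (PowerSeries.mk fun m : ℕ => (m : ℂ) * (qExpansion 1 E₄).coeff m) =
    (PowerSeries.mk fun m : ℕ => (if m = 0 then 1 else -24 * ((ArithmeticFunction.sigma 1 m : ℕ) : ℂ))) * qExpansion 1 E₄
      - qExpansion 1 E₆ := by
  obtain ⟨a1, c1⟩ := analytic_of_hasSum (f := normalizedDerivOfComplex ⇑E₄) (normalizedDerivOfComplex_mdifferentiable E₄.holo')
    hasSum_D_E4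
  obtain ⟨a2, c2⟩ := analytic_of_hasSum (f := E2) (c := fun m : ℕ => (if m = 0 then 1 else -24 * ((ArithmeticFunction.sigma 1 m : ℕ) : ℂ)))
    E2_mdifferentiable (fun τ ↦ by
    simpa only [Function.Periodic.qParam, Complex.ofReal_one, div_one] using
      hasSum_qExpansion_E2 (z := τ))
  have a3 : AnalyticAt ℂ (cuspFunction 1 E₄) 0 :=
    ModularFormClass.analyticAt_cuspFunction_zero E₄ one_pos one_mem_strictPeriods_SL
  have a4 : AnalyticAt ℂ (cuspFunction 1 (E2 * ⇑E₄)) 0 := by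
    rw [cuspFunction_mul a2.continuousAt a3.continuousAt]
    exact a2.mul a3
  have he : ⇑serreForm = normalizedDerivOfComplex E₄ - ((4 * 12⁻¹ : ℂ) • (E2 * ⇑E₄)) := by
    ext z
    change serreDerivative (4 : ℤ) E₄ z = _
    simp [mul_assoc]
  have a5 : AnalyticAt ℂ (cuspFunction 1 ((4 * 12⁻¹ : ℂ) • (E2 * ⇑E₄))) 0 := by
    rw [cuspFunction_smul a4.continuousAt]
    exact analyticAt_const.mul a4
  have hq : qExpansion 1 serreForm = qExpansion 1 (normalizedDerivOfComplex E₄)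
      - (4 * 12⁻¹ : ℂ) • (qExpansion 1 E2 * qExpansion 1 E₄) := by
    rw [he, qExpansion_sub a1 a5, qExpansion_smul a4, qExpansion_mul a2 a3]
  have h1 : qExpansion 1 (normalizedDerivOfComplex E₄) =
    (PowerSeries.mk fun m : ℕ => (m : ℂ) * (qExpansion 1 E₄).coeff m) := by
    ext m; rw [c1, PowerSeries.coeff_mk]
  have h2 : qExpansion 1 E2 =
    (PowerSeries.mk fun m : ℕ => (if m = 0 then 1 else -24 * ((ArithmeticFunction.sigma 1 m : ℕ) : ℂ))) := by
    ext m; rw [c2, PowerSeries.coeff_mk]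
  rw [h1, h2] at hq
  have hz : serreForm + (3⁻¹ : ℂ) • E₆ = 0 := by
    apply sturm_bound_levelOne
    change ((0 : ℕ) : ℕ∞) < _
    rw [FunLike.coe_add, ModularForm.qExpansion_add one_pos one_mem_strictPeriods_SL, FunLike.coe_smul,
      ModularForm.qExpansion_smul one_pos one_mem_strictPeriods_SL]
    rw [Nat.cast_zero, pos_iff_ne_zero, PowerSeries.order_ne_zero_iff_constCoeff_eq_zero, hq]
    rw [← PowerSeries.coeff_zero_eq_constantCoeff_apply]
    simp only [map_add, map_sub, PowerSeries.coeff_smul, PowerSeries.coeff_mk]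
    simp only [PowerSeries.coeff_mul, PowerSeries.coeff_mk, Finset.Nat.antidiagonal_zero, Finset.sum_singleton,
      E_qExpansion_coeff_zero _ (⟨2, rfl⟩ : Even 4),
      E_qExpansion_coeff_zero _ (⟨3, rfl⟩ : Even 6)]
    norm_num
  have hz2 : qExpansion 1 serreForm + (3⁻¹ : ℂ) • qExpansion 1 E₆ = 0 := by
    rw [← ModularForm.qExpansion_smul one_pos one_mem_strictPeriods_SL,
      ← FunLike.coe_smul, ← ModularForm.qExpansion_add one_pos one_mem_strictPeriods_SL, ← FunLike.coe_add, hz]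
    exact qExpansion_zero 1
  rw [hq] at hz2
  have := congrArg (fun x => (3 : ℂ) • x) hz2
  simp only [smul_add, smul_sub, smul_smul, smul_zero] at this
  rw [show (3 : ℂ) * (4 * 12⁻¹) = 1 by norm_num, show (3 : ℂ) * 3⁻¹ = 1 by norm_num, one_smul, one_smul,
    PowerSeries.smul_eq_C_mul, map_ofNat] at this
  rw [nsmul_eq_mul, Nat.cast_ofNat]
  linear_combination this

open UpperHalfPlane ModularForm EisensteinSeries MatrixGroups in
lemma disc_identity : 1728 * qExpansion 1 ModularForm.discriminant =
    (qExpansion 1 E₄) ^ 3 - (qExpansion 1 E₆) ^ 2 := by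
  let f : ModularForm 𝒮ℒ 12 :=
    ModularForm.mcast (by decide) (E₄.pow 3) - ModularForm.mcast (by decide) (E₆.pow 2)
  have hf : qExpansion 1 f = (qExpansion 1 E₄) ^ 3 - (qExpansion 1 E₆) ^ 2 := by
    simp only [f, FunLike.coe_sub, coe_mcast,
    ModularForm.qExpansion_sub one_pos one_mem_strictPeriods_SL,
    ModularForm.qExpansion_pow one_pos one_mem_strictPeriods_SL]
  have he : ⇑f = (1728 : ℂ) • ⇑CuspForm.discriminant := by
    ext z
    simp only [f, FunLike.coe_sub, coe_mcast, ModularForm.coe_pow, Pi.sub_apply, Pi.pow_apply, Pi.smul_apply,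
      CuspForm.coe_discriminant, discriminant_eq_E₄_cube_sub_E₆_sq, smul_eq_mul]
    ring
  rw [← hf, he, ModularForm.qExpansion_smul one_pos one_mem_strictPeriods_SL,
    PowerSeries.smul_eq_C_mul, CuspForm.coe_discriminant, map_ofNat]

noncomputable def eisZ (c : ℤ) (k : ℕ) : PowerSeries ℤ :=
  PowerSeries.mk fun m => if m = 0 then 1 else c * ((ArithmeticFunction.sigma k m : ℕ) : ℤ)

lemma eisZ_map {c : ℤ} {k : ℕ} {f : PowerSeries ℂ} {a : ℂ}
    (hf : ∀ m, f.coeff m = if m = 0 then 1 else a * ((ArithmeticFunction.sigma k m : ℕ) : ℂ))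
    (ha : a = c) : PowerSeries.map (Int.castRingHom ℂ) (eisZ c k) = f := by
  ext m
  rw [PowerSeries.coeff_map, hf, eisZ, PowerSeries.coeff_mk, ha]
  split_ifs <;> simp

open UpperHalfPlane ModularForm EisensteinSeries in
lemma E4_map : PowerSeries.map (Int.castRingHom ℂ) (eisZ 240 3) = qExpansion 1 E₄ := by
  refine eisZ_map (fun m => E_qExpansion_coeff _ ⟨2, rfl⟩ m) ?_
  norm_num [bernoulli_eq_bernoulli'_of_ne_one]

open UpperHalfPlane ModularForm EisensteinSeries in
lemma E6_map : PowerSeries.map (Int.castRingHom ℂ) (eisZ (-504) 5) = qExpansion 1 E₆ := by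
  refine eisZ_map (fun m => E_qExpansion_coeff _ ⟨3, rfl⟩ m) ?_
  have : bernoulli 6 = 1 / 42 := by
    rw [bernoulli_eq_bernoulli'_of_ne_one (by norm_num), bernoulli'_def]
    norm_num [Finset.sum_range_succ, Nat.choose, bernoulli'_eq_zero_of_odd (n := 5) (by decide) (by norm_num)]
  rw [this]
  norm_num

open UpperHalfPlane ModularForm EisensteinSeries in
lemma E8_map : PowerSeries.map (Int.castRingHom ℂ) (eisZ 480 7) =
    qExpansion 1 (E (by norm_num : 3 ≤ 8)) := by
  refine eisZ_map (fun m => E_qExpansion_coeff _ ⟨4, rfl⟩ m) ?_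
  have h6 : bernoulli' 6 = 1 / 42 := by
    rw [bernoulli'_def]
    norm_num [Finset.sum_range_succ, Nat.choose, bernoulli'_eq_zero_of_odd (n := 5) (by decide) (by norm_num)]
  have : bernoulli 8 = -1 / 30 := by
    rw [bernoulli_eq_bernoulli'_of_ne_one (by norm_num), bernoulli'_def]
    norm_num [Finset.sum_range_succ, Nat.choose, bernoulli'_eq_zero_of_odd (n := 5) (by decide) (by norm_num),
      bernoulli'_eq_zero_of_odd (n := 7) (by decide) (by norm_num), h6]
  rw [this]
  norm_num

lemma castZC_inj : Function.Injective (PowerSeries.map (Int.castRingHom ℂ)) :=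
  PowerSeries.map_injective _ Int.cast_injective

lemma id1Z : 1728 * (PowerSeries.mk ramanujanTau) = (eisZ 240 3) ^ 3 - (eisZ (-504) 5) ^ 2 := by
  apply castZC_inj
  rw [map_sub, map_pow, map_pow, E4_map, E6_map, ← disc_identity, map_mul, map_ofNat]
  congr 1
  ext n
  rw [disc_coeff]
  simp

lemma id2Z : 3 * (PowerSeries.mk fun m : ℕ => (m : ℤ) * (eisZ 240 3).coeff m) =
    eisZ (-24) 1 * eisZ 240 3 - eisZ (-504) 5 := by
  apply castZC_inj
  rw [map_sub, map_mul, map_mul, E4_map, E6_map, map_ofNat]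
  have h := serre_identity
  rw [nsmul_eq_mul, Nat.cast_ofNat] at h
  convert h using 2
  · congr 1
    ext m
    rw [← E4_map]
    simp
  · congr 1
    exact eisZ_map (a := -24) (fun m => by rw [PowerSeries.coeff_mk]) (by norm_num)

lemma id3Z : (eisZ 240 3) ^ 2 = eisZ 480 7 := by
  apply castZC_inj
  rw [map_pow, E4_map, E8_map, E4_sq]

lemma tau_mod7 (n : ℕ) : (ramanujanTau n : ZMod 7) = n * ((ArithmeticFunction.sigma 3 n : ℕ) : ZMod 7) := by
  let φ := PowerSeries.map (Int.castRingHom (ZMod 7))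
  have hR : φ (eisZ (-504) 5) = 1 := by
    ext m
    rw [PowerSeries.coeff_map, eisZ, PowerSeries.coeff_mk, PowerSeries.coeff_one]
    split_ifs
    · simp
    · rw [map_mul, show Int.castRingHom (ZMod 7) (-504) = 0 by decide, zero_mul]
  have hE : φ (eisZ 480 7) = φ (eisZ (-24) 1) := by
    ext m
    rw [PowerSeries.coeff_map, PowerSeries.coeff_map, eisZ, PowerSeries.coeff_mk, eisZ, PowerSeries.coeff_mk]
    split_ifs
    · simp
    · rw [map_mul, map_mul, show Int.castRingHom (ZMod 7) 480 = Int.castRingHom (ZMod 7) (-24) by decide]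
      congr 1
      simp [ArithmeticFunction.sigma_apply, ZMod.pow_card]
  have h1 := congrArg φ id1Z
  have h2 := congrArg φ id2Z
  have h3 := congrArg φ id3Z
  rw [map_sub, map_pow, map_pow, hR, map_mul] at h1
  rw [map_sub, map_mul, map_mul, hR] at h2
  rw [map_pow, hE] at h3
  have h4 : φ 1728 * φ (PowerSeries.mk ramanujanTau) =
      φ 3 * φ (PowerSeries.mk fun m : ℕ => (m : ℤ) * (eisZ 240 3).coeff m) := by
    linear_combination h1 - h2 + h3 * φ (eisZ 240 3)
  have h5 := congrArg (PowerSeries.coeff n) h4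
  have c1 : φ 1728 = PowerSeries.C (6 : ZMod 7) := by
    rw [map_ofNat]; rw [show (6 : ZMod 7) = OfNat.ofNat 1728 by decide, map_ofNat]
  have c2 : φ 3 = PowerSeries.C (3 : ZMod 7) := by
    rw [map_ofNat, map_ofNat]
  rw [c1, c2, PowerSeries.coeff_C_mul, PowerSeries.coeff_C_mul, PowerSeries.coeff_map, PowerSeries.coeff_map,
    PowerSeries.coeff_mk, PowerSeries.coeff_mk, eisZ, PowerSeries.coeff_mk] at h5
  rcases eq_or_ne n 0 with rfl | hn
  · simp [ramanujanTau]
  · rw [if_neg hn] at h5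
    push_cast at h5
    have e : (240 : ZMod 7) = 2 := by decide
    have e7 : (7 : ZMod 7) = 0 := by decide
    simp only [map_mul, eq_intCast, Int.cast_natCast, Int.cast_ofNat] at h5
    rw [e] at h5
    linear_combination (-1) * h5 + (ramanujanTau n - n * ((ArithmeticFunction.sigma 3 n : ℕ) : ZMod 7)) * e7

lemma t7_eq (n : ℕ) : t7 n = if (n * ((ArithmeticFunction.sigma 3 n : ℕ) : ZMod 7)) = 0 then 0 else 1 := by
  rw [t7, ← tau_mod7]
  congr 1
  rw [eq_iff_iff]
  exact (ZMod.intCast_zmod_eq_zero_iff_dvd _ 7).symm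

lemma t7_zero : t7 0 = 0 := by simp [t7_eq]

lemma t7_one : t7 1 = 1 := by simp [t7_eq]

lemma t7_mul {m n : ℕ} (h : m.Coprime n) : t7 (m * n) = t7 m * t7 n := by
  rw [t7_eq, t7_eq, t7_eq, ArithmeticFunction.isMultiplicative_sigma.map_mul_of_coprime h]
  have : (((m * n : ℕ) : ZMod 7) * ((ArithmeticFunction.sigma 3 m * ArithmeticFunction.sigma 3 n : ℕ) : ZMod 7))
    = (m * ((ArithmeticFunction.sigma 3 m : ℕ) : ZMod 7)) * (n * ((ArithmeticFunction.sigma 3 n : ℕ) : ZMod 7)) := by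
    push_cast; ring
  simp only [this, mul_eq_zero]
  by_cases a : (m * ((ArithmeticFunction.sigma 3 m : ℕ) : ZMod 7)) = 0 <;>
  by_cases b : (n * ((ArithmeticFunction.sigma 3 n : ℕ) : ZMod 7)) = 0 <;>
  simp only [mul_eq_zero] at a b <;> simp [a, b]

lemma t7_abs_le (n : ℕ) : |t7 n| ≤ 1 := by
  rw [t7_eq]; split_ifs <;> simp

lemma t7_pow {p : ℕ} (hp : p.Prime) (e : ℕ) :
    t7 (p ^ e) = if ((p : ZMod 7) ^ e * ∑ j ∈ range (e + 1), ((p : ZMod 7) ^ 3) ^ j) = 0 then 0 else 1 := by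
  rw [t7_eq, ArithmeticFunction.sigma_apply_prime_pow hp]
  push_cast
  simp only [← pow_mul, mul_comm]

lemma cast_mod7 (p : ℕ) : (p : ZMod 7) = ((p % 7 : ℕ) : ZMod 7) := by simp

lemma t7_pow_A {p : ℕ} (hp : p.Prime) (h : p % 7 = 3 ∨ p % 7 = 5 ∨ p % 7 = 6) (e : ℕ) :
    t7 (p ^ e) = if Even e then 1 else 0 := by
  have h0 : (p : ZMod 7) ≠ 0 ∧ (p : ZMod 7) ^ 3 = -1 := by
    rw [cast_mod7]
    rcases h with h | h | h <;> rw [h] <;> decide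
  rw [t7_pow hp, h0.2]
  simp only [mul_eq_zero, pow_ne_zero e h0.1, false_or, neg_one_geom_sum, Nat.even_add_one]
  by_cases he : Even e <;> simp [he]

lemma t7_pow_B {p : ℕ} (hp : p.Prime) (h : p % 7 = 1 ∨ p % 7 = 2 ∨ p % 7 = 4) (e : ℕ) :
    t7 (p ^ e) = if 7 ∣ e + 1 then 0 else 1 := by
  have h0 : (p : ZMod 7) ≠ 0 ∧ (p : ZMod 7) ^ 3 = 1 := by
    rw [cast_mod7]
    rcases h with h | h | h <;> rw [h] <;> decide
  rw [t7_pow hp, h0.2]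
  simp only [mul_eq_zero, pow_ne_zero e h0.1, false_or, one_pow, sum_const, card_range, nsmul_eq_mul,
    mul_one, ZMod.natCast_eq_zero_iff]

lemma t7_pow_seven (e : ℕ) : t7 (7 ^ e) = if e = 0 then 1 else 0 := by
  rw [t7_pow (by norm_num)]
  have : ((7 : ℕ) : ZMod 7) = 0 := by decide
  rw [this]
  by_cases he : e = 0 <;> simp [he]

lemma prime_class {p : ℕ} (hp : p.Prime) : p = 7 ∨ (p % 7 = 3 ∨ p % 7 = 5 ∨ p % 7 = 6) ∨
    (p % 7 = 1 ∨ p % 7 = 2 ∨ p % 7 = 4) := by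
  by_cases h : p % 7 = 0
  · left
    exact ((Nat.prime_dvd_prime_iff_eq (by norm_num) hp).mp (Nat.dvd_of_mod_eq_zero h)).symm
  · right; omega

lemma sumA {x : ℝ} (h0 : 0 ≤ x) (h1 : x < 1) :
    HasSum (fun e : ℕ => (if Even e then 1 else 0) * x ^ e) (1 - x ^ 2)⁻¹ := by
  have hi : Function.Injective (fun j : ℕ => 2 * j) := fun a b h => by simpa using h
  rw [← hi.hasSum_iff]
  · have := hasSum_geometric_of_lt_one (sq_nonneg x) (by nlinarith : x ^ 2 < 1)
    convert this using 2 with j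
    simp [pow_mul]
  · intro e he
    rw [if_neg, zero_mul]
    rintro ⟨k, rfl⟩
    exact he ⟨k, by ring⟩

lemma sumB {x : ℝ} (h0 : 0 ≤ x) (h1 : x < 1) :
    HasSum (fun e : ℕ => (if 7 ∣ e + 1 then 0 else 1) * x ^ e) ((1 - x ^ 6) / ((1 - x) * (1 - x ^ 7))) := by
  have h7 : x ^ 7 < 1 := pow_lt_one₀ h0 h1 (by norm_num)
  have hi : Function.Injective (fun j : ℕ => 7 * j + 6) := fun a b h => by simpa using h
  have hb : HasSum (fun e : ℕ => (if 7 ∣ e + 1 then 1 else 0) * x ^ e) (x ^ 6 * (1 - x ^ 7)⁻¹) := by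
    rw [← hi.hasSum_iff]
    · have := (hasSum_geometric_of_lt_one (pow_nonneg h0 7) h7).mul_left (x ^ 6)
      refine this.congr_fun fun j => ?_
      rw [Function.comp_apply, if_pos ⟨j + 1, by ring⟩, pow_add, pow_mul]
      ring
    · intro e he
      rw [if_neg, zero_mul]
      rintro ⟨k, hk⟩
      exact he ⟨k - 1, by simp only; omega⟩
  have := (hasSum_geometric_of_lt_one h0 h1).sub hb
  have e1 : (fun e : ℕ => (if 7 ∣ e + 1 then 0 else 1) * x ^ e) =
      fun e : ℕ => x ^ e - (if 7 ∣ e + 1 then 1 else 0) * x ^ e := by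
    funext e
    split_ifs <;> simp
  have n1 : 1 - x ≠ 0 := by linarith
  have n7 : 1 - x ^ 7 ≠ 0 := by linarith
  have e2 : (1 - x ^ 6) / ((1 - x) * (1 - x ^ 7)) = (1 - x)⁻¹ - x ^ 6 * (1 - x ^ 7)⁻¹ := by
    rw [div_eq_iff (mul_ne_zero n1 n7), sub_mul]
    field_simp
    ring
  rw [e1, e2]
  exact this

lemma mult_aux {g : ℝ → ℝ} (hg : DifferentiableAt ℝ g 0) (h0 : g 0 = 1) {x : Nat.Primes → ℝ}
    (hx : Summable x) (P : Nat.Primes → Prop) [DecidablePred P] :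
    Multipliable (fun p => if P p then g (x p) else 1) := by
  have hx' : Summable (fun p => if P p then x p else 0) := by
    refine (hx.indicator {p | P p}).congr fun p => ?_
    simp [Set.indicator_apply]
  have h1 := hg.isBigO_sub.comp_tendsto hx'.tendsto_cofinite_zero
  simp only [Function.comp_def, sub_zero] at h1
  have h2 := multipliable_one_add_of_summable (summable_of_isBigO hx' h1).norm
  refine h2.congr fun p => ?_
  split_ifs <;> simp [h0]

lemma tprod_conv (P : ℕ → Prop) [DecidablePred P] (g : ℕ → ℝ) :
    ∏' p : {p : ℕ // p.Prime ∧ P p}, g p.1 = ∏' p : Nat.Primes, if P p then g p else 1 := by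
  have h1 := _root_.tprod_subtype {p : ℕ | p.Prime ∧ P p} g
  have h2 := _root_.tprod_subtype {p : ℕ | p.Prime} (fun p => if P p then g p else 1)
  refine (h1.trans ?_).trans h2.symm
  congr 1
  ext n
  simp only [Set.mulIndicator_apply, Set.mem_ofPred_eq]
  by_cases a : n.Prime <;> by_cases b : P n <;> simp [a, b]

/-- The Euler product for `T(s) = ∑_{n≥1} t_n n^{-s}` in the `7 ∤ τ(n)` case, and the
resulting identity `T(s)² = ζ(s) L(s,χ₋₇) (1-7^{-s}) ∏…`, where `χ₋₇` is the quadratic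
character mod 7 (Kronecker character of `ℚ(√-7)`). -/
theorem T_seven_euler_product_and_square (s : ℝ) (hs : 1 < s)
    (χ : DirichletCharacter ℂ 7)
    (hχ : ∀ a : ℤ, χ (a : ZMod 7) = (legendreSym 7 a : ℂ)) :
    (∑' n : ℕ, t7 (n + 1) / ((n : ℝ) + 1) ^ s)
      = (∏' p : {p : ℕ // p.Prime ∧ (p % 7 = 3 ∨ p % 7 = 5 ∨ p % 7 = 6)},
            (1 - (p.1 : ℝ) ^ (-(2 * s)))⁻¹)
        * (∏' p : {p : ℕ // p.Prime ∧ (p % 7 = 1 ∨ p % 7 = 2 ∨ p % 7 = 4)},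
            (1 - (p.1 : ℝ) ^ (-(6 * s)))
              / ((1 - (p.1 : ℝ) ^ (-s)) * (1 - (p.1 : ℝ) ^ (-(7 * s))))) ∧
    (((∑' n : ℕ, t7 (n + 1) / ((n : ℝ) + 1) ^ s : ℝ) : ℂ)) ^ 2
      = riemannZeta s * DirichletCharacter.LFunction χ s * (1 - (7 : ℂ) ^ (-(s : ℂ)))
        * ((∏' p : {p : ℕ // p.Prime ∧ (p % 7 = 3 ∨ p % 7 = 5 ∨ p % 7 = 6)},
              (1 - (p.1 : ℝ) ^ (-(2 * s)))⁻¹ : ℝ) : ℂ)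
        * ((∏' p : {p : ℕ // p.Prime ∧ (p % 7 = 1 ∨ p % 7 = 2 ∨ p % 7 = 4)},
              ((1 - (p.1 : ℝ) ^ (-(6 * s))) / (1 - (p.1 : ℝ) ^ (-(7 * s)))) ^ 2 : ℝ) : ℂ) := by
  have hpw : ∀ (p : ℕ) (k : ℕ), (p : ℝ) ^ (-((k : ℝ) * s)) = ((p : ℝ) ^ (-s)) ^ k := by
    intro p k
    rw [← Real.rpow_natCast, ← Real.rpow_mul (Nat.cast_nonneg p)]
    congr 1; ring
  have hpw2 : ∀ p : ℕ, (p : ℝ) ^ (-(2 * s)) = ((p : ℝ) ^ (-s)) ^ 2 := fun p => by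
    simpa using hpw p 2
  have hpw6 : ∀ p : ℕ, (p : ℝ) ^ (-(6 * s)) = ((p : ℝ) ^ (-s)) ^ 6 := fun p => by
    simpa using hpw p 6
  have hpw7 : ∀ p : ℕ, (p : ℝ) ^ (-(7 * s)) = ((p : ℝ) ^ (-s)) ^ 7 := fun p => by
    simpa using hpw p 7
  simp only [hpw2, hpw6, hpw7]
  set x : Nat.Primes → ℝ := fun p => (p : ℝ) ^ (-s) with hx
  have hx0 : ∀ p, 0 ≤ x p := fun p => Real.rpow_nonneg (Nat.cast_nonneg _) _
  have hx1 : ∀ p, x p < 1 := fun p =>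
    Real.rpow_lt_one_of_one_lt_of_neg (by exact_mod_cast p.2.one_lt) (by linarith)
  have hxs : Summable x := Nat.Primes.summable_rpow.mpr (by linarith)
  rw [tprod_conv (fun p => p % 7 = 3 ∨ p % 7 = 5 ∨ p % 7 = 6) (fun p => (1 - ((p : ℝ) ^ (-s)) ^ 2)⁻¹),
    tprod_conv (fun p => p % 7 = 1 ∨ p % 7 = 2 ∨ p % 7 = 4)
      (fun p => (1 - ((p : ℝ) ^ (-s)) ^ 6) / ((1 - (p : ℝ) ^ (-s)) * (1 - ((p : ℝ) ^ (-s)) ^ 7))),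
    tprod_conv (fun p => p % 7 = 1 ∨ p % 7 = 2 ∨ p % 7 = 4)
      (fun p => ((1 - ((p : ℝ) ^ (-s)) ^ 6) / (1 - ((p : ℝ) ^ (-s)) ^ 7)) ^ 2)]
  have mA := mult_aux (g := fun y => (1 - y ^ 2)⁻¹) (by fun_prop (disch := norm_num)) (by norm_num) hxs
    (fun p => (p : ℕ) % 7 = 3 ∨ (p : ℕ) % 7 = 5 ∨ (p : ℕ) % 7 = 6)
  have mB := mult_aux (g := fun y => (1 - y ^ 6) / ((1 - y) * (1 - y ^ 7)))
    (by fun_prop (disch := norm_num)) (by norm_num) hxs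
    (fun p => (p : ℕ) % 7 = 1 ∨ (p : ℕ) % 7 = 2 ∨ (p : ℕ) % 7 = 4)
  have mC := mult_aux (g := fun y => ((1 - y ^ 6) / (1 - y ^ 7)) ^ 2)
    (by fun_prop (disch := norm_num)) (by norm_num) hxs
    (fun p => (p : ℕ) % 7 = 1 ∨ (p : ℕ) % 7 = 2 ∨ (p : ℕ) % 7 = 4)
  have hsum : Summable (fun n : ℕ => ‖t7 n / (n : ℝ) ^ s‖) := by
    refine Summable.of_nonneg_of_le (fun _ => norm_nonneg _) (fun n => ?_)
      (Real.summable_one_div_nat_rpow.mpr hs)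
    rw [norm_div, Real.norm_eq_abs, Real.norm_of_nonneg (Real.rpow_nonneg (Nat.cast_nonneg n) s)]
    exact div_le_div_of_nonneg_right (t7_abs_le n) (Real.rpow_nonneg (Nat.cast_nonneg n) s)
  have hE := EulerProduct.eulerProduct_hasProd (f := fun n : ℕ => t7 n / (n : ℝ) ^ s)
    (by simp [t7_one]) (by
      intro m n h
      simp only [t7_mul h, Nat.cast_mul, Real.mul_rpow (Nat.cast_nonneg m) (Nat.cast_nonneg n)]
      rw [mul_div_mul_comm]) hsum (by simp [t7_zero])
  have hT : ∑' n : ℕ, t7 n / (n : ℝ) ^ s = ∑' n : ℕ, t7 (n + 1) / ((n : ℝ) + 1) ^ s := by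
    rw [hsum.of_norm.tsum_eq_zero_add]
    simp [t7_zero]
  rw [hT] at hE
  have hterm : ∀ (p : Nat.Primes) (e : ℕ), t7 ((p : ℕ) ^ e) / (((p : ℕ) ^ e : ℕ) : ℝ) ^ s
      = t7 ((p : ℕ) ^ e) * x p ^ e := by
    intro p e
    rw [div_eq_mul_inv, hx]
    congr 1
    rw [← Real.rpow_natCast, ← Real.rpow_mul (Nat.cast_nonneg _), Nat.cast_pow, ← Real.rpow_natCast,
      ← Real.rpow_mul (Nat.cast_nonneg _), ← Real.rpow_neg (Nat.cast_nonneg _)]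
    congr 1; ring
  have hfac : ∀ p : Nat.Primes, ∑' e : ℕ, t7 ((p : ℕ) ^ e) / (((p : ℕ) ^ e : ℕ) : ℝ) ^ s =
      (if ((p : ℕ) % 7 = 3 ∨ (p : ℕ) % 7 = 5 ∨ (p : ℕ) % 7 = 6) then (1 - x p ^ 2)⁻¹ else 1) *
      (if ((p : ℕ) % 7 = 1 ∨ (p : ℕ) % 7 = 2 ∨ (p : ℕ) % 7 = 4) then
        (1 - x p ^ 6) / ((1 - x p) * (1 - x p ^ 7)) else 1) := by
    intro p
    simp only [hterm]
    rcases prime_class p.2 with h | h | h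
    · rw [if_neg (by rw [h]; norm_num), if_neg (by rw [h]; norm_num)]
      simp only [h, t7_pow_seven]
      rw [tsum_eq_single 0 (by intro b hb; simp [hb])]
      simp
    · rw [if_pos h, if_neg (by omega), mul_one, ← (sumA (hx0 p) (hx1 p)).tsum_eq]
      simp only [t7_pow_A p.2 h]
    · rw [if_neg (by omega), if_pos h, one_mul, ← (sumB (hx0 p) (hx1 p)).tsum_eq]
      simp only [t7_pow_B p.2 h]
  simp only [hfac] at hE
  refine ⟨?_, ?_⟩
  · rw [← hE.tprod_eq]
    exact Multipliable.tprod_mul mA mB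
  · have hre : 1 < (s : ℂ).re := by simpa using hs
    have hc := hE.map Complex.ofRealHom Complex.continuous_ofReal
    have cA := mA.hasProd.map Complex.ofRealHom Complex.continuous_ofReal
    have cC := mC.hasProd.map Complex.ofRealHom Complex.continuous_ofReal
    have hz := riemannZeta_eulerProduct_hasProd hre
    have hL := DirichletCharacter.LSeries_eulerProduct_hasProd χ hre
    rw [← DirichletCharacter.LFunction_eq_LSeries χ hre] at hL
    have h7 := hasProd_single (f := fun p : Nat.Primes => if (p : ℕ) = 7 then 1 - (7 : ℂ) ^ (-(s : ℂ)) else 1)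
      ⟨7, by norm_num⟩ (by
        intro p hp
        rw [if_neg]
        intro h
        exact hp (Subtype.ext h))
    simp only [if_true] at h7
    have hl := hc.mul hc
    rw [← sq] at hl
    refine hl.unique ?_
    have hr := (((hz.mul hL).mul h7).mul cA).mul cC
    refine hr.congr_fun fun p => ?_
    have hxc : ((p : ℕ) : ℂ) ^ (-(s : ℂ)) = (x p : ℂ) := by
      simp only [hx]
      rw [Complex.ofReal_cpow (Nat.cast_nonneg _)]
      simp
    have hχp : χ ((p : ℕ) : ZMod 7) = (legendreSym 7 ((p : ℕ) : ℤ) : ℂ) := by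
      rw [← hχ]; simp
    rw [hxc, hχp]
    have hleg : legendreSym 7 ((p : ℕ) : ℤ) = legendreSym 7 (((p : ℕ) % 7 : ℕ) : ℤ) := by
      rw [legendreSym.mod]; push_cast; rfl
    have n1 : (1 - (x p : ℂ)) ≠ 0 := by
      exact_mod_cast (sub_pos.mpr (hx1 p)).ne'
    have n1' : (1 + (x p : ℂ)) ≠ 0 := by
      exact_mod_cast (by linarith [hx0 p] : (0 : ℝ) < 1 + x p).ne'
    have n2 : (1 - (x p : ℂ) ^ 2) ≠ 0 := by
      exact_mod_cast (sub_pos.mpr (pow_lt_one₀ (hx0 p) (hx1 p) (n := 2) (by norm_num))).ne'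
    have n7 : (1 - (x p : ℂ) ^ 7) ≠ 0 := by
      exact_mod_cast (sub_pos.mpr (pow_lt_one₀ (hx0 p) (hx1 p) (n := 7) (by norm_num))).ne'
    simp only [Function.comp, Complex.ofRealHom_eq_coe]
    rcases prime_class p.2 with h | h | h
    · have e0 : legendreSym 7 ((p : ℕ) : ℤ) = 0 := by rw [h]; decide
      have e1 : (7 : ℂ) ^ (-(s : ℂ)) = x p := by rw [← hxc, h]; norm_num
      rw [e0, if_neg (by rw [h]; norm_num), if_neg (by rw [h]; norm_num), if_pos h, e1,
        if_neg (by rw [h]; norm_num)]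
      simp
      field_simp
    · have e0 : legendreSym 7 ((p : ℕ) : ℤ) = -1 := by
        rw [hleg]
        rcases h with h | h | h <;> rw [h] <;> decide
      rw [e0, if_pos h, if_neg (by omega), if_neg (by omega), if_neg (by omega)]
      push_cast
      rw [show (1 - (x p : ℂ) ^ 2) = (1 - x p) * (1 + x p) by ring]
      rw [show (1 - -1 * (x p : ℂ)) = 1 + x p by ring]
      field_simp
    · have e0 : legendreSym 7 ((p : ℕ) : ℤ) = 1 := by
        rw [hleg]
        rcases h with h | h | h <;> rw [h] <;> decide
      rw [e0, if_neg (by omega), if_pos h, if_neg (by omega), if_pos h]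
      push_cast
      field_simp
end

section
/- For every positive integer n, τ(n) ≡ n·σ₁(n) (mod 3), where σ₁(n) = ∑_{d | n} d; consequently, defining t_n = 1 if 3 ∤ τ(n) and t_n = 0 otherwise, the function n ↦ t_n is multiplicative and for real s > 1 one has T(s) := ∑_{n=1}^∞ t_n·n^{-s} = ∏_{p ≡ 2 (mod 3)} (1 − p^{-2s})^{-1} · ∏_{p ≡ 1 (mod 3)} (1 + p^{-s})/(1 − p^{-3s}), products over primes in the indicated residue classes. -/
open Finset

/-- `t n = 1` if `3 ∤ τ(n)`, and `t n = 0` otherwise. -/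
noncomputable def t3 (n : ℕ) : ℝ := if (3 : ℤ) ∣ ramanujanTau n then 0 else 1

section TauPart
open UpperHalfPlane Filter Topology

noncomputable def tauPoly (N : ℕ) : Polynomial ℤ :=
  Polynomial.X * ∏ k ∈ Finset.Icc 1 N, ((1 : Polynomial ℤ) - Polynomial.X ^ k) ^ 24

lemma tauPoly_coeff_stable (n N : ℕ) (h : n ≤ N) :
    (tauPoly N).coeff n = ramanujanTau n := by
  induction N, h using Nat.le_induction with
  | base => rfl
  | succ N hN ih =>
    rw [← ih]
    have h1 : tauPoly (N + 1) = tauPoly N * (1 - Polynomial.X ^ (N+1)) ^ 24 := by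
      simp only [tauPoly]
      rw [← Finset.insert_Icc_right_eq_Icc_add_one (by omega), Finset.prod_insert (by simp)]
      ring
    have h2 : (Polynomial.X : Polynomial ℤ) ^ (N+1) ∣ (1 - Polynomial.X ^ (N+1)) ^ 24 - 1 := by
      have := sub_dvd_pow_sub_pow ((1 : Polynomial ℤ) - Polynomial.X ^ (N+1)) 1 24
      rw [one_pow] at this
      refine dvd_trans ?_ this
      rw [show (1 : Polynomial ℤ) - Polynomial.X ^ (N+1) - 1 = -Polynomial.X ^ (N+1) by ring]
      exact (dvd_neg).2 dvd_rfl
    obtain ⟨R, hR⟩ := h2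
    have h3 : tauPoly (N + 1) = tauPoly N + Polynomial.X ^ (N+1) * (tauPoly N * R) := by
      rw [h1, sub_eq_iff_eq_add.1 hR]; ring
    rw [h3, Polynomial.coeff_add, Polynomial.coeff_X_pow_mul', if_neg (by omega), add_zero]

lemma tlu_iteratedDeriv {F : ℕ → ℂ → ℂ} {f : ℂ → ℂ} {U : Set ℂ} (hU : IsOpen U)
    (hF : ∀ n, Differentiable ℂ (F n)) (h : TendstoLocallyUniformlyOn F f atTop U) (k : ℕ) :
    TendstoLocallyUniformlyOn (fun n => iteratedDeriv k (F n)) (iteratedDeriv k f) atTop U := by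
  induction k with
  | zero => simpa using h
  | succ k ih =>
    simp only [iteratedDeriv_succ]
    refine ih.deriv (Filter.Eventually.of_forall fun n => ?_) hU
    exact ((hF n).contDiff (n := ⊤).differentiable_iteratedDeriv k
      (by simp)).differentiableOn

lemma iteratedDeriv_poly_zero (p : Polynomial ℤ) (k : ℕ) :
    iteratedDeriv k (fun z : ℂ => Polynomial.aeval z p) 0 = k.factorial * (p.coeff k : ℂ) := by
  have h : ∀ k, iteratedDeriv k (fun z : ℂ => Polynomial.aeval z p) =
      fun z => Polynomial.aeval z (Polynomial.derivative^[k] p) := by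
    intro k
    induction k with
    | zero => simp
    | succ k ih =>
      rw [iteratedDeriv_succ, ih, Function.iterate_succ_apply']
      ext z
      rw [Polynomial.deriv_aeval]
  rw [h]
  simp only [Polynomial.aeval_def, Polynomial.eval₂_at_zero]
  rw [Polynomial.coeff_iterate_derivative]
  simp [Nat.descFactorial_self]

lemma tau_qExp (n : ℕ) :
    (qExpansion 1 ModularForm.discriminant).coeff n = (ramanujanTau n : ℂ) := by
  have h0 := ModularForm.multipliableLocallyUniformlyOn_one_sub_pow.hasProdLocallyUniformlyOn
  have hU : IsOpen (Metric.ball (0:ℂ) 1) := Metric.isOpen_ball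
  have h1 : TendstoLocallyUniformlyOn (fun N (q : ℂ) => ∏ i ∈ Finset.range N, (1 - q ^ (i+1)))
      (fun q => ∏' i, (1 - q ^ (i+1))) atTop (Metric.ball (0:ℂ) 1) := by
    intro u hu x hx
    obtain ⟨t, ht, h⟩ := h0 u hu x hx
    exact ⟨t, ht, tendsto_finset_range.eventually h⟩
  have hd : ContinuousOn (fun q : ℂ => ∏' i, (1 - q ^ (i+1))) (Metric.ball (0:ℂ) 1) :=
    (h1.differentiableOn (Filter.Eventually.of_forall fun n => by fun_prop) hU).continuousOn
  have h2 : ∀ k : ℕ, TendstoLocallyUniformlyOn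
      (fun N (q : ℂ) => (∏ i ∈ Finset.range N, (1 - q ^ (i+1))) ^ k)
      (fun q => (∏' i, (1 - q ^ (i+1))) ^ k) atTop (Metric.ball (0:ℂ) 1) := by
    intro k
    induction k with
    | zero =>
      simp only [pow_zero]
      exact fun u hu x hx => ⟨Set.univ, univ_mem, .of_forall fun n y _ => refl_mem_uniformity hu⟩
    | succ k ih =>
      have := ih.mul₀ h1 (hd.pow k) hd
      simp only [pow_succ]
      exact this
  have hc : TendstoLocallyUniformlyOn
      (fun (N : ℕ) (q : ℂ) => q) (fun q => q) atTop (Metric.ball (0:ℂ) 1) :=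
    fun u hu x hx => ⟨Set.univ, univ_mem, .of_forall fun n y _ => refl_mem_uniformity hu⟩
  have h3 := hc.mul₀ (h2 24) continuousOn_id (hd.pow 24)
  have h4 : TendstoLocallyUniformlyOn (fun N (q : ℂ) => Polynomial.aeval q (tauPoly N))
      (cuspFunction 1 ModularForm.discriminant) atTop (Metric.ball (0:ℂ) 1) := by
    refine (h3.congr_right (g := cuspFunction 1 ModularForm.discriminant) ?_).congr ?_
    · intro q hq
      rw [ModularForm.discriminant_cuspFunction_eqOn hq]
      simp only [Pi.mul_apply]
      rw [(ModularForm.multipliable_one_sub_pow (by simpa using hq)).tprod_pow 24]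
    · intro N q hq
      simp only [Pi.mul_apply, tauPoly, map_mul, Polynomial.aeval_X, map_prod, map_pow, map_sub,
        map_one]
      rw [← Finset.prod_pow, Finset.range_eq_Ico, Finset.prod_Ico_add'
        (fun i => (1 - q ^ i) ^ 24) 0 N 1]
      rfl
  have h5 := tlu_iteratedDeriv hU (fun N => by
    exact Polynomial.differentiable_aeval _) h4 n
  have h6 := h5.tendsto_at (Metric.mem_ball_self one_pos)
  simp only [iteratedDeriv_poly_zero] at h6
  have h7 : Tendsto (fun N => (n.factorial : ℂ) * ((tauPoly N).coeff n : ℂ)) atTop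
      (𝓝 ((n.factorial : ℂ) * (ramanujanTau n : ℂ))) := by
    refine tendsto_const_nhds.congr' ?_
    filter_upwards [eventually_ge_atTop n] with N hN
    rw [tauPoly_coeff_stable n N hN]
  rw [qExpansion_coeff, tendsto_nhds_unique h6 h7]
  exact inv_mul_cancel_left₀ (by exact_mod_cast n.factorial_ne_zero) _
end TauPart

section EisPart
open UpperHalfPlane ModularForm EisensteinSeries MatrixGroups

noncomputable def sigSer (r : ℕ) : PowerSeries ℤ :=
  PowerSeries.mk fun n => (ArithmeticFunction.sigma r n : ℤ)

noncomputable def tauSer : PowerSeries ℤ := PowerSeries.mk ramanujanTau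

lemma qExp_E_eq {k : ℕ} (hk : 3 ≤ k) (hk2 : Even k) (c : ℤ)
    (hc : -(2 * k / bernoulli k : ℂ) = c) :
    qExpansion 1 (E hk) = PowerSeries.map (Int.castRingHom ℂ) (1 + PowerSeries.C c * sigSer (k-1)) := by
  ext m
  rw [E_qExpansion_coeff hk hk2, hc]
  rcases eq_or_ne m 0 with rfl | hm
  · rw [PowerSeries.coeff_map, map_add, PowerSeries.coeff_C_mul, sigSer, PowerSeries.coeff_mk, PowerSeries.coeff_one]
    simp
  · rw [PowerSeries.coeff_map, map_add, PowerSeries.coeff_C_mul, sigSer, PowerSeries.coeff_mk, PowerSeries.coeff_one]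
    simp [hm]

lemma qExp_E4 : qExpansion 1 E₄ =
    PowerSeries.map (Int.castRingHom ℂ) (1 + PowerSeries.C (240:ℤ) * sigSer 3) :=
  qExp_E_eq _ ⟨2, rfl⟩ 240 (by norm_num [show bernoulli 4 = -1 / 30 by decide +kernel])

lemma qExp_E6 : qExpansion 1 E₆ =
    PowerSeries.map (Int.castRingHom ℂ) (1 + PowerSeries.C (-504:ℤ) * sigSer 5) :=
  qExp_E_eq _ ⟨3, rfl⟩ (-504) (by norm_num [show bernoulli 6 = 1 / 42 by decide +kernel])

noncomputable def E8 : ModularForm 𝒮ℒ 8 := E (by norm_num : 3 ≤ 8)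

lemma qExp_E8 : qExpansion 1 E8 =
    PowerSeries.map (Int.castRingHom ℂ) (1 + PowerSeries.C (480:ℤ) * sigSer 7) :=
  qExp_E_eq _ ⟨4, rfl⟩ (480) (by norm_num [show bernoulli 8 = -1 / 30 by decide +kernel])

lemma mapInt_inj {f g : PowerSeries ℤ}
    (h : PowerSeries.map (Int.castRingHom ℂ) f = PowerSeries.map (Int.castRingHom ℂ) g) : f = g :=
  PowerSeries.map_injective _ (RingHom.injective_int _) h

lemma E8_id : 1 + PowerSeries.C (480:ℤ) * sigSer 7 = (1 + PowerSeries.C (240:ℤ) * sigSer 3) ^ 2 := by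
  apply mapInt_inj
  rw [map_pow, ← qExp_E8, ← qExp_E4]
  set F : ModularForm 𝒮ℒ 8 := E8 - ModularForm.mcast (by decide) (E₄.pow 2) with hF
  have hq : qExpansion 1 F = qExpansion 1 E8 - qExpansion 1 E₄ ^ 2 := by
    simp only [hF, FunLike.coe_sub, coe_mcast,
      ModularForm.qExpansion_sub one_pos one_mem_strictPeriods_SL,
      ModularForm.qExpansion_pow one_pos one_mem_strictPeriods_SL]
  have : F = 0 := by
    apply sturm_bound_levelOne
    rw [hq]
    have h0 : ((0 : ℕ) : ℕ∞) < (qExpansion 1 E8 - qExpansion 1 E₄ ^ 2).order := by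
      apply lt_of_lt_of_le (b := ((1:ℕ) : ℕ∞)) (by norm_num)
      apply PowerSeries.nat_le_order
      intro i hi
      obtain rfl : i = 0 := by omega
      rw [qExp_E8, qExp_E4, ← map_pow, ← map_sub, PowerSeries.coeff_map,
        PowerSeries.coeff_zero_eq_constantCoeff]
      have hs (r : ℕ) : PowerSeries.constantCoeff (sigSer r) = 0 := by
        rw [← PowerSeries.coeff_zero_eq_constantCoeff]; simp [sigSer, -PowerSeries.coeff_zero_eq_constantCoeff]
      rw [map_sub, map_pow, map_add, map_add, map_mul, map_mul, hs, hs]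
      simp
    simpa using h0
  rw [this] at hq
  have h2 : qExpansion 1 (⇑(0 : ModularForm 𝒮ℒ 8)) = 0 := by
    simp [qExpansion_zero]
  rw [h2] at hq
  exact (sub_eq_zero.1 hq.symm)

lemma Delta_id : PowerSeries.C (1728:ℤ) * tauSer =
    (1 + PowerSeries.C (240:ℤ) * sigSer 3) ^ 3 - (1 + PowerSeries.C (-504:ℤ) * sigSer 5) ^ 2 := by
  apply mapInt_inj
  rw [map_sub, map_pow, map_pow, ← qExp_E4, ← qExp_E6]
  set F : ModularForm 𝒮ℒ 12 :=
    ModularForm.mcast (by decide) (E₄.pow 3) - ModularForm.mcast (by decide) (E₆.pow 2) with hF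
  have hq : qExpansion 1 F = qExpansion 1 E₄ ^ 3 - qExpansion 1 E₆ ^ 2 := by
    simp only [hF, FunLike.coe_sub, coe_mcast,
      ModularForm.qExpansion_sub one_pos one_mem_strictPeriods_SL,
      ModularForm.qExpansion_pow one_pos one_mem_strictPeriods_SL]
  rw [← hq]
  have hFe : (F : ℍ → ℂ) = (1728 : ℂ) • CuspForm.discriminant := by
    ext z
    have := discriminant_eq_E₄_cube_sub_E₆_sq z
    simp only [hF, coe_mcast, ModularForm.coe_pow, sub_apply, Pi.pow_apply, Pi.smul_apply, smul_eq_mul,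
      CuspForm.coe_discriminant, this]
    ring
  rw [hFe, ModularForm.qExpansion_smul one_pos one_mem_strictPeriods_SL]
  ext n
  rw [PowerSeries.coeff_map, PowerSeries.coeff_C_mul]
  simp [tauSer, tau_qExp]

lemma main_id : PowerSeries.C (12:ℤ) * tauSer = PowerSeries.C (-5:ℤ) * sigSer 3 + PowerSeries.C (7:ℤ) * sigSer 5 + PowerSeries.C (10:ℤ) * sigSer 7
    + PowerSeries.C (96000:ℤ) * sigSer 3 ^ 3 - PowerSeries.C (1764:ℤ) * sigSer 5 ^ 2 := by
  have h1 := E8_id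
  have h2 := Delta_id
  have h3 : PowerSeries.C (144 : ℤ) ≠ 0 := by
    exact (map_ne_zero_iff _ PowerSeries.C_injective).2 (by norm_num)
  apply mul_left_cancel₀ h3
  simp only [map_ofNat, map_neg] at *
  linear_combination h2 - 3 * h1

lemma coeff_cube_dvd (f : PowerSeries ℤ) (n : ℕ) (hn : ¬ 3 ∣ n) :
    (3 : ℤ) ∣ (f ^ 3).coeff n := by
  obtain ⟨m, rfl⟩ : ∃ m, n = m + 1 := ⟨n - 1, by grind⟩
  have h := PowerSeries.coeff_derivative (f ^ 3) m
  rw [Derivation.leibniz_pow] at h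
  have h3 : (3 : ℤ) ∣ (f ^ 3).coeff (m+1) * ((m : ℤ) + 1) := by
    rw [← h, map_nsmul, nsmul_eq_mul]
    exact dvd_mul_right _ _
  have hp : Prime (3 : ℤ) := Int.prime_three
  rcases hp.dvd_or_dvd h3 with h | h
  · exact h
  · exact absurd (by exact_mod_cast h) hn

lemma tau_dvd (n : ℕ) : (3 : ℤ) ∣ ((n : ℤ) - 1) * ramanujanTau n := by
  rcases n with _ | m
  · simp [ramanujanTau]
  · set A : Polynomial ℤ := ∏ k ∈ Finset.Icc 1 (m+1), ((1 : Polynomial ℤ) - Polynomial.X ^ k)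
    have ht : ramanujanTau (m+1) = (A^24).coeff m := by
      simp only [ramanujanTau]
      rw [Finset.prod_pow, Polynomial.coeff_X_mul]
    rw [ht]
    rcases m with _ | m
    · simp
    · have h := Polynomial.coeff_derivative (A ^ 24) m
      rw [Polynomial.derivative_pow] at h
      have : ((m + 1 + 1 : ℕ) : ℤ) - 1 = (m : ℤ) + 1 := by push_cast; ring
      rw [this, mul_comm, ← h, mul_assoc, Polynomial.coeff_C_mul]
      exact Dvd.dvd.mul_right (by norm_num) _

lemma sigma_comb (n : ℕ) (hn : ¬ 3 ∣ n) :
    (9 : ℤ) ∣ 4 * (ArithmeticFunction.sigma 3 n : ℤ) + 7 * (ArithmeticFunction.sigma 5 n : ℤ)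
      + (ArithmeticFunction.sigma 7 n : ℤ) - 3 * (ArithmeticFunction.sigma 1 n : ℤ) := by
  simp only [ArithmeticFunction.sigma_apply]
  push_cast
  simp only [Finset.mul_sum]
  rw [← Finset.sum_add_distrib, ← Finset.sum_add_distrib, ← Finset.sum_sub_distrib]
  refine Finset.dvd_sum fun d hd => ?_
  have hd3 : ¬ 3 ∣ d := fun h => hn (h.trans (Nat.dvd_of_mem_divisors hd))
  have h9 : ∀ x : ZMod 9, 3 * x ≠ 0 → 4 * x ^ 3 + 7 * x ^ 5 + x ^ 7 - 3 * x ^ 1 = 0 := by decide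
  have h1 : (3 * (d : ZMod 9)) ≠ 0 := by
    intro h
    have : ((3 * d : ℕ) : ZMod 9) = 0 := by push_cast; exact h
    rw [ZMod.natCast_eq_zero_iff] at this
    omega
  have := h9 d h1
  refine (ZMod.intCast_zmod_eq_zero_iff_dvd _ 9).1 ?_
  push_cast
  exact this

lemma tau_modEq (n : ℕ) :
    ramanujanTau n ≡ (n : ℤ) * (ArithmeticFunction.sigma 1 n : ℤ) [ZMOD 3] := by
  have h1 := tau_dvd n
  by_cases hn : 3 ∣ n
  · obtain ⟨m, rfl⟩ := hn
    obtain ⟨c, hc⟩ := h1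
    apply Int.ModEq.symm
    rw [Int.modEq_iff_dvd]
    push_cast at *
    refine ⟨m * ramanujanTau (3*m) - c - m * (ArithmeticFunction.sigma 1 (3*m) : ℤ), ?_⟩
    linear_combination -hc
  · obtain ⟨c, hc⟩ := h1
    obtain ⟨d, hd⟩ := sigma_comb n hn
    obtain ⟨e, he⟩ := coeff_cube_dvd (sigSer 3) n hn
    have h := congrArg (PowerSeries.coeff n) main_id
    simp only [map_add, map_sub, PowerSeries.coeff_C_mul, he] at h
    simp only [tauSer, sigSer, PowerSeries.coeff_mk] at h
    generalize (PowerSeries.coeff n) ((PowerSeries.mk fun n => ((ArithmeticFunction.sigma 5 n : ℕ) : ℤ))^2) = w at h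
    have h3 : (3:ℤ) ∣ ramanujanTau n - (ArithmeticFunction.sigma 1 n : ℤ) := by omega
    obtain ⟨f, hf⟩ := h3
    apply Int.ModEq.symm
    rw [Int.modEq_iff_dvd]
    refine ⟨n * f - c, ?_⟩
    linear_combination (n:ℤ) * hf - hc
end EisPart


section EulerPart

lemma t3_eq (n : ℕ) :
    t3 n = if ((n * ArithmeticFunction.sigma 1 n : ℕ) : ZMod 3) = 0 then 0 else 1 := by
  have h := tau_modEq n
  have h2 : (3 : ℤ) ∣ ramanujanTau n ↔ ((n * ArithmeticFunction.sigma 1 n : ℕ) : ZMod 3) = 0 := by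
    rw [ZMod.natCast_eq_zero_iff, ← Int.natCast_dvd_natCast]
    push_cast
    exact h.dvd_iff
  simp only [t3, h2]

lemma t3_one' : t3 1 = 1 := by
  rw [t3_eq]; simp

lemma t3_zero' : t3 0 = 0 := by
  rw [t3_eq]; simp

lemma t3_mul' (m n : ℕ) (h : Nat.Coprime m n) : t3 (m * n) = t3 m * t3 n := by
  have : Fact (Nat.Prime 3) := ⟨Nat.prime_three⟩
  rw [t3_eq, t3_eq, t3_eq, ArithmeticFunction.isMultiplicative_sigma.map_mul_of_coprime h]
  have : ((m * n * (ArithmeticFunction.sigma 1 m * ArithmeticFunction.sigma 1 n) : ℕ) : ZMod 3)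
    = ((m * ArithmeticFunction.sigma 1 m : ℕ) : ZMod 3) *
      ((n * ArithmeticFunction.sigma 1 n : ℕ) : ZMod 3) := by
    push_cast; ring
  simp only [this, mul_eq_zero]
  split_ifs <;> simp_all

lemma t3_bd (n : ℕ) : 0 ≤ t3 n ∧ t3 n ≤ 1 := by
  unfold t3; split_ifs <;> norm_num

lemma t3_pp (p e : ℕ) (hp : p.Prime) :
    t3 (p ^ e) = if (p : ZMod 3) ^ e * ∑ i ∈ Finset.range (e + 1), (p : ZMod 3) ^ i = 0
      then 0 else 1 := by
  rw [t3_eq, ArithmeticFunction.sigma_one_apply_prime_pow hp]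
  push_cast
  rfl

lemma t3_pp0 (e : ℕ) : t3 (3 ^ (e + 1)) = 0 := by
  rw [t3_pp 3 _ Nat.prime_three]
  have : ((3 : ℕ) : ZMod 3) = 0 := by decide
  rw [this]; simp

lemma t3_pp1 (p e : ℕ) (hp : p.Prime) (h : p % 3 = 1) :
    t3 (p ^ e) = if e % 3 = 2 then 0 else 1 := by
  rw [t3_pp p e hp]
  have : (p : ZMod 3) = 1 := by
    rw [← ZMod.natCast_mod, h]; rfl
  rw [this]
  have h2 : ((e + 1 : ℕ) : ZMod 3) = 0 ↔ e % 3 = 2 := by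
    rw [ZMod.natCast_eq_zero_iff]; omega
  push_cast at h2
  simp [h2]

lemma t3_pp2 (p e : ℕ) (hp : p.Prime) (h : p % 3 = 2) :
    t3 (p ^ e) = if e % 2 = 1 then 0 else 1 := by
  have : Fact (Nat.Prime 3) := ⟨Nat.prime_three⟩
  rw [t3_pp p e hp]
  have : (p : ZMod 3) = -1 := by
    rw [← ZMod.natCast_mod, h]; rfl
  rw [this, neg_one_geom_sum]
  have : Even (e + 1) ↔ e % 2 = 1 := by rw [Nat.even_iff]; omega
  simp [this]

lemma local_sum (c : ℕ → ℝ) (k : ℕ) (hc : ∀ e, c (e + k) = c e) (x : ℝ)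
    (hs : Summable fun e => c e * x ^ e) :
    (∑' e, c e * x ^ e) * (1 - x ^ k) = ∑ i ∈ Finset.range k, c i * x ^ i := by
  have h := hs.sum_add_tsum_nat_add k
  have h2 : (∑' e, c (e + k) * x ^ (e + k)) = (∑' e, c e * x ^ e) * x ^ k := by
    rw [← tsum_mul_right]
    congr 1; ext e
    rw [hc, pow_add]; ring
  rw [h2] at h
  linarith

lemma euler_part (s : ℝ) (hs : 1 < s) :
    (∑' n : ℕ, t3 (n + 1) / ((n : ℝ) + 1) ^ s)
        = (∏' p : {p : ℕ // p.Prime ∧ p % 3 = 2}, (1 - (p.1 : ℝ) ^ (-(2 * s)))⁻¹)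
          * (∏' p : {p : ℕ // p.Prime ∧ p % 3 = 1},
              (1 + (p.1 : ℝ) ^ (-s)) / (1 - (p.1 : ℝ) ^ (-(3 * s)))) := by
  set f : ℕ → ℝ := fun n => t3 n * (n : ℝ) ^ (-s) with hf
  have hS : Summable (fun n : ℕ => (n : ℝ) ^ (-s)) := Real.summable_nat_rpow.2 (by linarith)
  have hfn : Summable (‖f ·‖) := by
    refine hS.of_nonneg_of_le (fun n => norm_nonneg _) fun n => ?_
    have h1 := t3_bd n
    have h2 : (0:ℝ) ≤ (n : ℝ) ^ (-s) := by positivity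
    rw [Real.norm_of_nonneg (mul_nonneg h1.1 h2)]
    exact mul_le_of_le_one_left h2 h1.2
  have hfs : Summable f := hfn.of_norm
  have hf0 : f 0 = 0 := by simp [hf, t3_zero']
  have hf1 : f 1 = 1 := by simp [hf, t3_one']
  have hfm : ∀ {m n : ℕ}, Nat.Coprime m n → f (m * n) = f m * f n := by
    intro m n h
    simp only [hf, t3_mul' m n h]
    push_cast
    rw [Real.mul_rpow (by positivity) (by positivity)]
    ring
  have hL : (∑' n : ℕ, t3 (n + 1) / ((n : ℝ) + 1) ^ s) = ∑' n, f n := by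
    rw [hfs.tsum_eq_zero_add, hf0, zero_add]
    congr 1; ext n
    simp only [hf]
    push_cast
    rw [Real.rpow_neg (by positivity), div_eq_mul_inv]
  rw [hL]
  have hE := EulerProduct.eulerProduct_hasProd_mulIndicator hf1 hfm hfn hf0
  set u : ℕ → ℝ := fun p => (1 - (p : ℝ) ^ (-(2 * s)))⁻¹ with hu
  set v : ℕ → ℝ := fun p => (1 + (p : ℝ) ^ (-s)) / (1 - (p : ℝ) ^ (-(3 * s))) with hv
  have hx : ∀ p : ℕ, p.Prime → 0 ≤ (p : ℝ) ^ (-s) ∧ (p : ℝ) ^ (-s) ≤ 1 / 2 := by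
    intro p hp
    refine ⟨by positivity, ?_⟩
    have h2 : (2 : ℝ) ≤ p := by exact_mod_cast hp.two_le
    calc (p : ℝ) ^ (-s) ≤ (p : ℝ) ^ (-1 : ℝ) :=
          Real.rpow_le_rpow_of_exponent_le (by linarith) (by linarith)
      _ = 1 / p := by rw [Real.rpow_neg_one, one_div]
      _ ≤ 1 / 2 := one_div_le_one_div_of_le (by norm_num) h2
  have hxk : ∀ (p k : ℕ), (p : ℝ) ^ (-((k : ℝ) * s)) = ((p : ℝ) ^ (-s)) ^ k := by
    intro p k
    rw [← Real.rpow_natCast, ← Real.rpow_mul (by positivity)]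
    congr 1; ring
  have hx2 : ∀ p : ℕ, (p : ℝ) ^ (-(2 * s)) = ((p : ℝ) ^ (-s)) ^ 2 := fun p => by
    simpa using hxk p 2
  have hx3 : ∀ p : ℕ, (p : ℝ) ^ (-(3 * s)) = ((p : ℝ) ^ (-s)) ^ 3 := fun p => by
    simpa using hxk p 3
  have hfp : ∀ p e : ℕ, f (p ^ e) = t3 (p ^ e) * ((p : ℝ) ^ (-s)) ^ e := by
    intro p e
    simp only [hf]
    congr 1
    push_cast
    rw [← Real.rpow_natCast, ← Real.rpow_mul (by positivity), ← Real.rpow_natCast,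
      ← Real.rpow_mul (by positivity)]
    congr 1; ring
  have hsp : ∀ p : ℕ, p.Prime → Summable fun e => f (p ^ e) := fun p hp =>
    hfs.comp_injective (Nat.pow_right_injective hp.two_le)
  have h3 : ∑' e, f (3 ^ e) = 1 := by
    rw [tsum_eq_single 0]
    · simpa using hf1
    · intro e he
      obtain ⟨m, rfl⟩ := Nat.exists_eq_succ_of_ne_zero he
      simp only [hf, Nat.succ_eq_add_one, t3_pp0, zero_mul]
  have h1 : ∀ p : ℕ, p.Prime → p % 3 = 1 → ∑' e, f (p ^ e) = v p := by
    intro p hp h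
    obtain ⟨a, b⟩ := hx p hp
    have hc := local_sum (fun e => if e % 3 = 2 then 0 else 1) 3 (fun e => by simp) ((p : ℝ) ^ (-s))
      (by simpa only [hfp, t3_pp1 p _ hp h] using hsp p hp)
    simp only [hfp, t3_pp1 p _ hp h, hv, hx3]
    rw [eq_div_iff, hc]
    · simp [Finset.sum_range_succ]
    · have : ((p : ℝ) ^ (-s)) ^ 3 ≤ (1 / 2) ^ 3 := pow_le_pow_left₀ a b 3
      intro h; linarith
  have h2 : ∀ p : ℕ, p.Prime → p % 3 = 2 → ∑' e, f (p ^ e) = u p := by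
    intro p hp h
    obtain ⟨a, b⟩ := hx p hp
    have hc := local_sum (fun e => if e % 2 = 1 then 0 else 1) 2 (fun e => by simp) ((p : ℝ) ^ (-s))
      (by simpa only [hfp, t3_pp2 p _ hp h] using hsp p hp)
    simp only [hfp, t3_pp2 p _ hp h, hu, hx2]
    rw [← one_div, eq_div_iff, hc]
    · simp [Finset.sum_range_succ]
    · have : ((p : ℝ) ^ (-s)) ^ 2 ≤ (1 / 2) ^ 2 := pow_le_pow_left₀ a b 2
      intro h; linarith
  have hmul : ∀ (A : Set ℕ) (w : ℕ → ℝ),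
      (∀ p ∈ A, |w p - 1| ≤ 4 * (p : ℝ) ^ (-s)) → Multipliable (A.mulIndicator w) := by
    intro A w hw
    have : A.mulIndicator w = fun n => 1 + (A.mulIndicator w n - 1) := by ext n; ring
    rw [this]
    apply Real.multipliable_one_add_of_summable
    refine (hS.mul_left 4).of_norm_bounded fun n => ?_
    by_cases hn : n ∈ A
    · rw [Set.mulIndicator_of_mem hn]; exact hw n hn
    · rw [Set.mulIndicator_of_notMem hn]; simp; positivity
  have hm2 : Multipliable ({p : ℕ | p.Prime ∧ p % 3 = 2}.mulIndicator u) := by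
    apply hmul
    rintro p ⟨hp, -⟩
    obtain ⟨a, b⟩ := hx p hp
    simp only [hu, hx2]
    generalize (p : ℝ) ^ (-s) = x at a b
    have h0 : 3 / 4 ≤ 1 - x ^ 2 := by nlinarith
    have : (1 - x ^ 2)⁻¹ - 1 = x ^ 2 / (1 - x ^ 2) := by field_simp; ring
    rw [this, abs_of_nonneg (div_nonneg (by positivity) (by linarith)), div_le_iff₀ (by linarith)]
    nlinarith
  have hm1 : Multipliable ({p : ℕ | p.Prime ∧ p % 3 = 1}.mulIndicator v) := by
    apply hmul
    rintro p ⟨hp, -⟩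
    obtain ⟨a, b⟩ := hx p hp
    simp only [hv, hx3]
    generalize (p : ℝ) ^ (-s) = x at a b
    have hq : x ^ 2 ≤ 1 / 4 := by nlinarith
    have hq3 : x ^ 3 ≤ x / 4 := by nlinarith [mul_le_mul_of_nonneg_left hq a]
    have h0 : 3 / 4 ≤ 1 - x ^ 3 := by linarith
    have : (1 + x) / (1 - x ^ 3) - 1 = (x + x ^ 3) / (1 - x ^ 3) := by
      have : 1 - x ^ 3 ≠ 0 := by intro h; linarith
      field_simp; ring
    rw [this, abs_of_nonneg (div_nonneg (by positivity) (by linarith)), div_le_iff₀ (by linarith)]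
    nlinarith
  have hsplit : (Set.mulIndicator {p | Nat.Prime p} fun p ↦ ∑' e, f (p ^ e)) =
      fun n => {p : ℕ | p.Prime ∧ p % 3 = 2}.mulIndicator u n *
        {p : ℕ | p.Prime ∧ p % 3 = 1}.mulIndicator v n := by
    ext p
    by_cases hp : p.Prime
    · have h5 : p % 3 = 0 ∨ p % 3 = 1 ∨ p % 3 = 2 := by omega
      rcases h5 with h | h | h
      · obtain rfl : p = 3 := ((Nat.prime_dvd_prime_iff_eq Nat.prime_three hp).1
          (Nat.dvd_of_mod_eq_zero h)).symm
        simp [Set.mulIndicator, hp, h3]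
      · simp [Set.mulIndicator, hp, h, h1 p hp h]
      · simp [Set.mulIndicator, hp, h, h2 p hp h]
    · simp [Set.mulIndicator, hp]
  rw [hsplit] at hE
  rw [← hE.tprod_eq, hm2.tprod_mul hm1, ← _root_.tprod_subtype, ← _root_.tprod_subtype]
  rfl

end EulerPart

/-- `τ(n) ≡ n σ₁(n) (mod 3)`; consequently `t` is multiplicative and
`T(s) = ∏_{p ≡ 2 (3)} (1-p^{-2s})⁻¹ ∏_{p ≡ 1 (3)} (1+p^{-s})/(1-p^{-3s})`. -/
theorem tau_mod_three_t_multiplicative_and_euler_product :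
    (∀ n : ℕ, 1 ≤ n →
      ramanujanTau n ≡ (n : ℤ) * (ArithmeticFunction.sigma 1 n : ℤ) [ZMOD 3]) ∧
    (t3 1 = 1 ∧ ∀ m n : ℕ, Nat.Coprime m n → t3 (m * n) = t3 m * t3 n) ∧
    ∀ s : ℝ, 1 < s →
      (∑' n : ℕ, t3 (n + 1) / ((n : ℝ) + 1) ^ s)
        = (∏' p : {p : ℕ // p.Prime ∧ p % 3 = 2}, (1 - (p.1 : ℝ) ^ (-(2 * s)))⁻¹)
          * (∏' p : {p : ℕ // p.Prime ∧ p % 3 = 1},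
              (1 + (p.1 : ℝ) ^ (-s)) / (1 - (p.1 : ℝ) ^ (-(3 * s)))) := by
  exact ⟨fun n _ => tau_modEq n, ⟨t3_one', t3_mul'⟩, euler_part⟩
end
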